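/- arXiv:2311.15013 — 3 statements merged into one kernel-verified Lean document; each statement's English description precedes it below -/
import Mathlib

section
/- For each integer h ≥ 1 and each complex q with |q| < 1, the generating function ã_h(q) := Σ_{n≥0} a_h(n) q^n satisfies ã_h(q) = (−q;q)_∞ · [ Σ_{j=0}^{⌈h/2⌉−1} q^h C(h−j−1, j)_{q²} Σ_{m≥0} (q^{2m+1}; q²)_j q^{(2h−4j)m} + Σ_{j=0}^{⌊h/2⌋−1} q^{3h−4j−3} C(h−j−2, j)_{q²} Σ_{m≥0} (q^{2m+3}; q²)_j q^{(2h−4j−2)m} ]. -/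
open Finset

/-- The number of parts of the partition `P` that are greater than `j`;
this is the length of column `j` (0-indexed) of the Ferrers diagram,
i.e. the conjugate part `λ'_{j+1}`. -/
def colLen {n : ℕ} (P : Nat.Partition n) (j : ℕ) : ℕ :=
  (P.parts.filter (fun p => j < p)).card

/-- The length of row `i` (0-indexed) of the Ferrers diagram of `P`,
i.e. the `(i+1)`-st largest part `λ_{i+1}` (or `0` if there is none). -/
def rowLen {n : ℕ} (P : Nat.Partition n) (i : ℕ) : ℕ :=
  ((Finset.range (n + 1)).filter (fun j => i < colLen P j)).card

/-- The number of cells of the Ferrers diagram of `P` whose hook number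
`(λ_i − j) + (λ'_j − i) + 1` (1-indexed) equals `h`. -/
def hookCount {n : ℕ} (P : Nat.Partition n) (h : ℕ) : ℕ :=
  (((Finset.range (n + 1)) ×ˢ (Finset.range (n + 1))).filter
    (fun ij => ij.2 < rowLen P ij.1 ∧
      rowLen P ij.1 + colLen P ij.2 = h + ij.1 + ij.2 + 1)).card

/-- `a h n`: the total number of hooks of length `h` among partitions of `n` into odd parts. -/
def hookOdd (h n : ℕ) : ℕ := ∑ P ∈ Nat.Partition.odds n, hookCount P h

/-- `b h n`: the total number of hooks of length `h` among partitions of `n` into distinct parts. -/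
def hookDistinct (h n : ℕ) : ℕ := ∑ P ∈ Nat.Partition.distincts n, hookCount P h

/-- The finite q-Pochhammer symbol `(x;q)_n = ∏_{i=0}^{n−1} (1 − x qⁱ)`. -/
def qPoch (x q : ℂ) (n : ℕ) : ℂ := ∏ i ∈ Finset.range n, (1 - x * q ^ i)

/-- The infinite product `(−q;q)_∞ = ∏_{i=1}^∞ (1 + qⁱ)`. -/
noncomputable def negqInf (q : ℂ) : ℂ := ∏' i : ℕ, (1 + q ^ (i + 1))

/-- The Gaussian binomial coefficient `C(n,k)_q = (q;q)_n / ((q;q)_k (q;q)_{n−k})`. -/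
noncomputable def qBinom (n k : ℕ) (q : ℂ) : ℂ := qPoch q q n / (qPoch q q k * qPoch q q (n - k))

/-- The generating function `ã_h(q) = Σ_{n≥0} a_h(n) qⁿ`. -/
noncomputable def atilde (h : ℕ) (q : ℂ) : ℂ := ∑' n : ℕ, (hookOdd h n : ℂ) * q ^ n

/-- The generating function `b̃_h(q) = Σ_{n≥0} b_h(n) qⁿ`. -/
noncomputable def btilde (h : ℕ) (q : ℂ) : ℂ := ∑' n : ℕ, (hookDistinct h n : ℂ) * q ^ n

/-- The cardinality of a bounded initial segment of `ℕ` detects membership. -/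
theorem lt_card_filter_range_iff {p : ℕ → Prop} [DecidablePred p] {N : ℕ}
    (hp : ∀ i j, i ≤ j → p j → p i) (hN : ∀ j, p j → j < N) (j : ℕ) :
    j < ((range N).filter p).card ↔ p j := by
  constructor
  · intro h
    by_contra hj
    have : (range N).filter p ⊆ range j := by
      intro x hx
      simp only [mem_filter, mem_range] at hx ⊢
      by_contra hxj
      exact hj (hp j x (by omega) hx.2)
    have := card_le_card this
    simp at this
    omega
  · intro h
    have : range (j + 1) ⊆ (range N).filter p := by
      intro x hx
      simp only [mem_filter, mem_range] at hx ⊢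
      exact ⟨by have := hN j h; omega, hp x j (by omega) h⟩
    have := card_le_card this
    simp at this
    omega

theorem colLen_eq_countP {n : ℕ} (P : Nat.Partition n) (j : ℕ) :
    colLen P j = P.parts.countP (fun x => j < x) := by
  rw [colLen, Multiset.countP_eq_card_filter]

theorem mem_parts_le {n : ℕ} (P : Nat.Partition n) {x : ℕ} (hx : x ∈ P.parts) : x ≤ n := by
  have := Multiset.le_sum_of_mem hx
  rwa [P.parts_sum] at this

theorem lt_rowLen_iff {n : ℕ} (P : Nat.Partition n) (i j : ℕ) :
    j < rowLen P i ↔ i < colLen P j := by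
  refine lt_card_filter_range_iff (p := fun j => i < colLen P j) ?_ ?_ j
  · intro a b hab h
    refine lt_of_lt_of_le h ?_
    exact Multiset.card_le_card (Multiset.monotone_filter_right _ (fun x hx => by omega))
  · intro k hk
    have : 0 < colLen P k := by omega
    rw [colLen_eq_countP, Multiset.countP_pos] at this
    obtain ⟨x, hx, hkx⟩ := this
    have := mem_parts_le P hx
    omega

theorem rowLen_eq_succ_iff {n : ℕ} (P : Nat.Partition n) (i v : ℕ) :
    rowLen P i = v + 1 ↔ colLen P (v + 1) ≤ i ∧ i < colLen P v := by
  have h1 := lt_rowLen_iff P i v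
  have h2 := lt_rowLen_iff P i (v + 1)
  omega

/-- The multiset `s` consists of odd numbers, none of them in `[c, c + 2 * t)`. -/
def OddAvoid (c t : ℕ) (s : Multiset ℕ) : Prop :=
  ∀ x ∈ s, Odd x ∧ ¬(c ≤ x ∧ x < c + 2 * t)

/-- The multiset `s` of odd numbers avoids `[c, c + 2 * t)`, has at most `l` elements in
`[c, v)` and more than `l` elements in `[c, v]`, where `v = c + 2 * t + 2 * r`. -/
def BandCond (c t r l : ℕ) (s : Multiset ℕ) : Prop :=
  OddAvoid c t s ∧ s.countP (fun x => c ≤ x ∧ x < c + 2 * t + 2 * r) ≤ l ∧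
    l < s.countP (fun x => c ≤ x ∧ x ≤ c + 2 * t + 2 * r)

theorem BandCond.mem {c t r l : ℕ} {s : Multiset ℕ} (h : BandCond c t r l s) :
    c + 2 * t + 2 * r ∈ s := by
  by_contra hv
  have : s.countP (fun x => c ≤ x ∧ x < c + 2 * t + 2 * r) =
      s.countP (fun x => c ≤ x ∧ x ≤ c + 2 * t + 2 * r) := by
    refine Multiset.countP_congr rfl fun x hx => ?_
    have : x ≠ c + 2 * t + 2 * r := fun e => hv (e ▸ hx)
    simp only [eq_iff_iff]
    omega
  have := h.2
  omega

theorem countP_lt_eq_add (s : Multiset ℕ) {j v : ℕ} (hjv : j ≤ v) :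
    s.countP (fun x => j < x) =
      s.countP (fun x => j + 1 ≤ x ∧ x ≤ v) + s.countP (fun x => v < x) := by
  induction s using Multiset.induction with
  | empty => simp
  | cons a s ih =>
    simp only [Multiset.countP_cons, ih]
    split_ifs <;> omega

/-- `BandCond` for a partition into odd parts, in terms of column lengths. -/
theorem bandCond_iff {n : ℕ} (P : Nat.Partition n) (hP : ∀ x ∈ P.parts, Odd x)
    {j c r l : ℕ} (hc : c = j + 1 ∨ c = j + 2) (hodd : Odd c) :
    BandCond c 0 r l P.parts ↔ colLen P j ≤ colLen P (c + 2 * r - 1) + l ∧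
      colLen P (c + 2 * r) + l < colLen P j := by
  have h1 := countP_lt_eq_add P.parts (j := j) (v := c + 2 * r - 1) (by omega)
  have h2 := countP_lt_eq_add P.parts (j := j) (v := c + 2 * r) (by omega)
  have e1 : P.parts.countP (fun x => c ≤ x ∧ x < c + 2 * 0 + 2 * r) =
      P.parts.countP (fun x => j + 1 ≤ x ∧ x ≤ c + 2 * r - 1) := by
    refine Multiset.countP_congr rfl fun x hx => ?_
    obtain ⟨k, hk⟩ := hP x hx
    obtain ⟨k', hk'⟩ := hodd
    simp only [eq_iff_iff]
    omega
  have e2 : P.parts.countP (fun x => c ≤ x ∧ x ≤ c + 2 * 0 + 2 * r) =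
      P.parts.countP (fun x => j + 1 ≤ x ∧ x ≤ c + 2 * r) := by
    refine Multiset.countP_congr rfl fun x hx => ?_
    obtain ⟨k, hk⟩ := hP x hx
    obtain ⟨k', hk'⟩ := hodd
    simp only [eq_iff_iff]
    omega
  have e3 : OddAvoid c 0 P.parts := fun x hx => ⟨hP x hx, by omega⟩
  simp only [BandCond, e1, e2, e3, colLen_eq_countP, true_and]
  omega

open Classical in
/-- The cells with arm length `a` and hook number `h` of a partition into odd parts. -/
theorem card_hook_arm {n : ℕ} (P : Nat.Partition n) (hP : ∀ x ∈ P.parts, Odd x)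
    (h a r e : ℕ) (he : e ≤ 1) (ha : a = 2 * r + e) (hah : a < h) :
    (((range (n + 1)) ×ˢ (range (n + 1))).filter (fun ij => rowLen P ij.1 = ij.2 + a + 1 ∧
      rowLen P ij.1 + colLen P ij.2 = h + ij.1 + ij.2 + 1)).card =
    ((range (n + 1)).filter (fun m =>
      BandCond (2 * m + 1 + 2 * e) 0 r (h - 1 - a) P.parts)).card := by
  have key : ∀ m, BandCond (2 * m + 1 + 2 * e) 0 r (h - 1 - a) P.parts ↔
      colLen P (2 * m + e) ≤ colLen P (2 * m + e + a) + (h - 1 - a) ∧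
      colLen P (2 * m + e + a + 1) + (h - 1 - a) < colLen P (2 * m + e) := by
    intro m
    rw [bandCond_iff P hP (j := 2 * m + e) (by omega) ⟨m + e, by ring⟩]
    have e1 : 2 * m + 1 + 2 * e + 2 * r - 1 = 2 * m + e + a := by omega
    have e2 : 2 * m + 1 + 2 * e + 2 * r = 2 * m + e + a + 1 := by omega
    rw [e1, e2]
  have odd_row : ∀ i w, rowLen P i = w + 1 → Odd (w + 1) := by
    intro i w hw
    rw [rowLen_eq_succ_iff, colLen_eq_countP, colLen_eq_countP,
      countP_lt_eq_add P.parts (Nat.le_succ w)] at hw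
    have : 0 < P.parts.countP (fun x => w + 1 ≤ x ∧ x ≤ w.succ) := by
      simp only [Nat.succ_eq_add_one] at hw ⊢
      omega
    rw [Multiset.countP_pos] at this
    obtain ⟨x, hx, hx1, hx2⟩ := this
    have : x = w + 1 := by omega
    exact this ▸ hP x hx
  refine card_nbij' (fun ij => ij.2 / 2)
    (fun m => (colLen P (2 * m + e) - (h - a), 2 * m + e)) ?_ ?_ ?_ ?_
  · rintro ⟨i, j⟩ hij
    simp only [coe_filter, mem_product, mem_range, Set.mem_ofPred_eq] at hij ⊢
    obtain ⟨⟨hi, hj⟩, hr, hk⟩ := hij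
    obtain ⟨k, hk'⟩ := odd_row i _ hr
    have hj2 : 2 * (j / 2) + e = j := by omega
    refine ⟨by omega, ?_⟩
    rw [key, hj2]
    rw [rowLen_eq_succ_iff] at hr
    have := (rowLen_eq_succ_iff P i (j + a)).2 hr
    omega
  · intro m hm
    simp only [coe_filter, mem_product, mem_range, Set.mem_ofPred_eq] at hm ⊢
    obtain ⟨hm, hb⟩ := hm
    have hv := mem_parts_le P hb.mem
    rw [key] at hb
    have hr : rowLen P (colLen P (2 * m + e) - (h - a)) = 2 * m + e + a + 1 := by
      rw [rowLen_eq_succ_iff]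
      omega
    refine ⟨⟨?_, by omega⟩, hr, by omega⟩
    have : colLen P (2 * m + e) ≤ n := by
      refine (Multiset.card_le_card (Multiset.filter_le _ _)).trans ?_
      have : ∀ x ∈ P.parts, 1 ≤ x := fun x hx => P.parts_pos hx
      have := Multiset.card_nsmul_le_sum this
      rw [P.parts_sum] at this
      simpa using this
    omega
  · rintro ⟨i, j⟩ hij
    simp only [coe_filter, mem_product, mem_range, Set.mem_ofPred_eq] at hij ⊢
    obtain ⟨⟨hi, hj⟩, hr, hk⟩ := hij
    obtain ⟨k, hk'⟩ := odd_row i _ hr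
    have hj2 : 2 * (j / 2) + e = j := by omega
    simp only [hj2, Prod.mk.injEq, and_true]
    omega
  · intro m hm
    show (2 * m + e) / 2 = m
    omega

theorem sum_range_parity {M : Type*} [AddCommMonoid M] (f : ℕ → M) (h : ℕ) :
    ∑ a ∈ range h, f a =
      ∑ r ∈ range ((h + 1) / 2), f (2 * r) + ∑ r ∈ range (h / 2), f (2 * r + 1) := by
  induction h with
  | zero => simp
  | succ h ih =>
    rw [sum_range_succ, ih]
    rcases Nat.even_or_odd' h with ⟨k, rfl | rfl⟩
    · rw [show (2 * k + 1 + 1) / 2 = k + 1 by omega, show (2 * k + 1) / 2 = k by omega,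
        show 2 * k / 2 = k by omega, sum_range_succ]
      abel
    · rw [show (2 * k + 1 + 1 + 1) / 2 = k + 1 by omega,
        show (2 * k + 1 + 1) / 2 = k + 1 by omega,
        show (2 * k + 1) / 2 = k by omega, sum_range_succ _ k,
        sum_range_succ (fun r => f (2 * r + 1)) k]
      abel

open Classical in
theorem hookCount_eq {n : ℕ} (P : Nat.Partition n) (hP : ∀ x ∈ P.parts, Odd x) (h : ℕ) :
    hookCount P h =
      ∑ r ∈ range ((h + 1) / 2), ((range (n + 1)).filter (fun m =>
        BandCond (2 * m + 1) 0 r (h - 1 - 2 * r) P.parts)).card +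
      ∑ r ∈ range (h / 2), ((range (n + 1)).filter (fun m =>
        BandCond (2 * m + 3) 0 r (h - 1 - (2 * r + 1)) P.parts)).card := by
  have h1 : hookCount P h = ∑ a ∈ range h, (((range (n + 1)) ×ˢ (range (n + 1))).filter
      (fun ij => rowLen P ij.1 = ij.2 + a + 1 ∧
        rowLen P ij.1 + colLen P ij.2 = h + ij.1 + ij.2 + 1)).card := by
    rw [hookCount, card_eq_sum_card_fiberwise (f := fun ij => rowLen P ij.1 - ij.2 - 1)
      (t := range h)]
    · refine sum_congr rfl fun a _ => congrArg card ?_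
      rw [filter_filter]
      refine filter_congr fun ij _ => ?_
      omega
    · rintro ⟨i, j⟩ hij
      simp only [coe_filter, mem_product, mem_range, Set.mem_ofPred_eq, coe_range, Set.mem_Iio]
        at hij ⊢
      have := (lt_rowLen_iff P i j).1 hij.2.1
      omega
  rw [h1, sum_range_parity]
  congr 1
  · refine sum_congr rfl fun r hr => ?_
    rw [mem_range] at hr
    exact card_hook_arm P hP h (2 * r) r 0 (by omega) rfl (by omega)
  · refine sum_congr rfl fun r hr => ?_
    rw [mem_range] at hr
    exact card_hook_arm P hP h (2 * r + 1) r 1 le_rfl rfl (by omega)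

open Classical in
/-- The weight `q ^ s.sum` of a multiset `s`, restricted to the multisets satisfying `p`. -/
noncomputable def msWeight {R : Type*} [Semiring R] (q : R) (p : Multiset ℕ → Prop)
    (s : Multiset ℕ) : R :=
  if p s then q ^ s.sum else 0

theorem oddAvoid_zero_iff {c : ℕ} {s : Multiset ℕ} : OddAvoid c 0 s ↔ ∀ x ∈ s, Odd x :=
  forall₂_congr fun x _ => by simp

/-- The type of all partitions into odd parts is in weight-preserving bijection with the type of
finite sets of natural numbers, by Euler's theorem. -/
theorem exists_odds_equiv_finset : ∃ e : (Σ n : ℕ, {P // P ∈ Nat.Partition.odds n}) ≃ Finset ℕ,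
    ∀ x, x.1 = ∑ i ∈ e x, (i + 1) := by
  have e1 : ∀ n, Nonempty
      ({P // P ∈ Nat.Partition.odds n} ≃ {P // P ∈ Nat.Partition.distincts n}) :=
    fun n => ⟨Fintype.equivOfCardEq (by
      simpa using Nat.Partition.card_odds_eq_card_distincts n)⟩
  let f : Finset ℕ → Σ n : ℕ, {P // P ∈ Nat.Partition.distincts n} := fun S =>
    ⟨∑ i ∈ S, (i + 1), ⟨⟨S.1.map (· + 1), by simp, rfl⟩, by
      simpa [Nat.Partition.distincts] using S.2.map (add_left_injective 1)⟩⟩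
  have hf : Function.Bijective f := by
    constructor
    · intro S T hST
      have h1 : ∀ x y : (Σ n : ℕ, {P // P ∈ Nat.Partition.distincts n}), x = y →
          x.2.1.parts = y.2.1.parts := by rintro x _ rfl; rfl
      have h2 := h1 _ _ hST
      exact Finset.val_injective (Multiset.map_injective (add_left_injective 1) h2)
    · rintro ⟨n, ⟨parts, pos, rfl⟩, hP⟩
      have hnd : parts.Nodup := by simpa [Nat.Partition.distincts] using hP
      have hmap : (parts.map (· - 1)).map (· + 1) = parts := by
        rw [Multiset.map_map]
        conv_rhs => rw [← Multiset.map_id parts]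
        refine Multiset.map_congr rfl fun x hx => ?_
        have := pos hx
        simp only [Function.comp, id]
        omega
      have hnd' : (parts.map (· - 1)).Nodup := by
        refine Multiset.Nodup.of_map (· + 1) ?_
        rwa [hmap]
      refine ⟨⟨parts.map (· - 1), hnd'⟩, ?_⟩
      have hs : ∑ i ∈ (⟨parts.map (· - 1), hnd'⟩ : Finset ℕ), (i + 1) = parts.sum := by
        show ((parts.map (· - 1)).map (· + 1)).sum = _
        rw [hmap]
      have gen : ∀ (m n : ℕ) (P : m.Partition) (Q : n.Partition)
          (hP : P ∈ Nat.Partition.distincts m) (hQ : Q ∈ Nat.Partition.distincts n),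
          P.parts = Q.parts → (⟨m, ⟨P, hP⟩⟩ : Σ n : ℕ, {P // P ∈ Nat.Partition.distincts n}) =
            ⟨n, ⟨Q, hQ⟩⟩ := by
        intro m n P Q hP hQ h
        obtain rfl : m = n := by rw [← P.parts_sum, ← Q.parts_sum, h]
        obtain rfl := Nat.Partition.ext h
        rfl
      exact gen _ _ _ _ _ _ hmap
  refine ⟨(Equiv.sigmaCongrRight fun n => (e1 n).some).trans (Equiv.ofBijective f hf).symm,
    fun x => ?_⟩
  set y := Equiv.sigmaCongrRight (fun n => (e1 n).some) x with hy
  have h1 : x.1 = y.1 := rfl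
  rw [h1]
  obtain ⟨S, hS⟩ := hf.2 y
  have : (Equiv.ofBijective f hf).symm y = S := by
    rw [Equiv.symm_apply_eq]
    exact hS.symm
  simp only [Equiv.trans_apply, ← hy, this]
  rw [← hS]

/-- The parts of a partition into odd parts, forgetting the size. -/
def oddParts (x : Σ n : ℕ, {P // P ∈ Nat.Partition.odds n}) : Multiset ℕ := x.2.1.parts

theorem oddParts_sum (x) : (oddParts x).sum = x.1 := x.2.1.parts_sum

theorem odd_of_mem_oddParts (x) : ∀ i ∈ oddParts x, Odd i := by
  have := x.2.2
  simp only [Nat.Partition.odds, Nat.Partition.restricted, mem_filter, Nat.not_even_iff_odd] at this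
  exact this.2

theorem oddParts_injective : Function.Injective oddParts := by
  rintro ⟨m, P, hP⟩ ⟨n, Q, hQ⟩ h
  have h : P.parts = Q.parts := h
  obtain rfl : m = n := by rw [← P.parts_sum, ← Q.parts_sum, h]
  obtain rfl := Nat.Partition.ext h
  rfl

theorem mem_range_oddParts {s : Multiset ℕ} (hs : ∀ x ∈ s, Odd x) : s ∈ Set.range oddParts :=
  ⟨⟨s.sum, ⟨⟨s, fun {i} hi => (hs i hi).pos, rfl⟩, by
    simpa [Nat.Partition.odds, Nat.Partition.restricted] using hs⟩⟩, rfl⟩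

theorem support_msWeight_subset {R : Type*} [Semiring R] (q : R) {p : Multiset ℕ → Prop}
    (hp : ∀ s, p s → ∀ x ∈ s, Odd x) :
    Function.support (msWeight q p) ⊆ Set.range oddParts := by
  intro s hs
  refine mem_range_oddParts (hp s ?_)
  by_contra h
  simp [msWeight, h] at hs

theorem pow_odds_equiv {R : Type*} [CommSemiring R] (q : R)
    (e : (Σ n : ℕ, {P // P ∈ Nat.Partition.odds n}) ≃ Finset ℕ)
    (he : ∀ x, x.1 = ∑ i ∈ e x, (i + 1)) (x) : q ^ x.1 = ∏ i ∈ e x, q ^ (i + 1) := by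
  rw [he x, prod_pow_eq_pow_sum]

theorem summable_msWeight_odd_real {x : ℝ} (hx0 : 0 ≤ x) (hx : x < 1) :
    Summable (msWeight x (fun s => ∀ i ∈ s, Odd i)) := by
  rw [← oddParts_injective.summable_iff (fun s hs => by
    by_contra h
    exact hs (support_msWeight_subset x (fun _ h => h) h))]
  obtain ⟨e, he⟩ := exists_odds_equiv_finset
  have h1 : (msWeight x (fun s => ∀ i ∈ s, Odd i)) ∘ oddParts =
      (fun S : Finset ℕ => ∏ i ∈ S, x ^ (i + 1)) ∘ e := by
    funext y
    simp only [Function.comp, msWeight, if_pos (odd_of_mem_oddParts y), oddParts_sum]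
    exact pow_odds_equiv x e he y
  rw [h1, e.summable_iff]
  refine summable_finsetProd_of_summable_norm (f := fun i : ℕ => x ^ (i + 1)) ?_
  refine Summable.norm ?_
  exact (summable_nat_add_iff 1).2 (summable_geometric_of_lt_one hx0 hx)

section

variable {q : ℂ}

theorem norm_msWeight_le {p p' : Multiset ℕ → Prop} (hp : ∀ s, p s → p' s) (s : Multiset ℕ) :
    ‖msWeight q p s‖ ≤ msWeight ‖q‖ p' s := by
  unfold msWeight
  by_cases h : p s
  · rw [if_pos h, if_pos (hp s h), norm_pow]
  · rw [if_neg h, norm_zero]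
    split_ifs <;> positivity

theorem summable_msWeight (hq : ‖q‖ < 1) {p : Multiset ℕ → Prop}
    (hp : ∀ s, p s → ∀ x ∈ s, Odd x) : Summable (msWeight q p) :=
  Summable.of_norm_bounded (summable_msWeight_odd_real (norm_nonneg q) hq)
    (norm_msWeight_le hp)

theorem tsum_msWeight_odd (hq : ‖q‖ < 1) {p : Multiset ℕ → Prop}
    (hp : ∀ s, p s ↔ ∀ x ∈ s, Odd x) : ∑' s, msWeight q p s = negqInf q := by
  rw [← oddParts_injective.tsum_eq (support_msWeight_subset q fun s => (hp s).1)]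
  obtain ⟨e, he⟩ := exists_odds_equiv_finset
  have h1 : ∀ y, msWeight q p (oddParts y) = ∏ i ∈ e y, q ^ (i + 1) := by
    intro y
    rw [msWeight, if_pos ((hp _).2 (odd_of_mem_oddParts y)), oddParts_sum]
    exact pow_odds_equiv q e he y
  simp_rw [h1]
  rw [e.tsum_eq (fun S : Finset ℕ => ∏ i ∈ S, q ^ (i + 1)), negqInf]
  refine (tprod_one_add (summable_finsetProd_of_summable_norm ?_)).symm
  simp_rw [norm_pow]
  exact (summable_nat_add_iff 1).2 (summable_geometric_of_lt_one (norm_nonneg q) hq)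

/-- Splitting a sum over multisets of odd numbers according to membership of `b`. -/
theorem tsum_msWeight_split (hq : ‖q‖ < 1) {p : Multiset ℕ → Prop} (b : ℕ)
    (hp : ∀ s, p s → ∀ x ∈ s, Odd x) :
    ∑' s, msWeight q p s = q ^ b * ∑' s, msWeight q (fun s => p (b ::ₘ s)) s +
      ∑' s, msWeight q (fun s => p s ∧ b ∉ s) s := by
  have h1 : ∑' s, msWeight q (fun s => p s ∧ b ∈ s) s =
      q ^ b * ∑' s, msWeight q (fun s => p (b ::ₘ s)) s := by
    have hinj : Function.Injective (fun s => b ::ₘ s) := fun s t => (Multiset.cons_inj_right b).1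
    rw [← hinj.tsum_eq, ← tsum_mul_left]
    · refine tsum_congr fun s => ?_
      by_cases h : p (b ::ₘ s) <;> simp [msWeight, h, pow_add]
    · intro s hs
      by_cases h : p s ∧ b ∈ s
      · obtain ⟨t, rfl⟩ := Multiset.exists_cons_of_mem h.2
        exact ⟨t, rfl⟩
      · simp [msWeight, h] at hs
  rw [← h1, ← Summable.tsum_add (summable_msWeight hq fun s h => hp s h.1)
    (summable_msWeight hq fun s h => hp s h.1)]
  refine tsum_congr fun s => ?_
  by_cases h : p s <;> by_cases hb : b ∈ s <;> simp [msWeight, h, hb]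

theorem tsum_msWeight_congr {p p' : Multiset ℕ → Prop} (h : ∀ s, p s ↔ p' s) :
    ∑' s, msWeight q p s = ∑' s, msWeight q p' s := by
  rw [funext fun s => propext (h s)]

theorem tsum_msWeight_false {p : Multiset ℕ → Prop} (h : ∀ s, ¬ p s) :
    ∑' s, msWeight q p s = 0 := by
  simp [msWeight, h]

theorem oddAvoid_cons {c t : ℕ} {s : Multiset ℕ} (hc : Odd c) :
    OddAvoid c t ((c + 2 * t) ::ₘ s) ↔ OddAvoid c t s := by
  simp only [OddAvoid, Multiset.forall_mem_cons, and_iff_right_iff_imp]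
  exact fun _ => ⟨hc.add_even (even_two_mul t), by omega⟩

theorem oddAvoid_succ_iff {c t : ℕ} {s : Multiset ℕ} (hc : Odd c) :
    OddAvoid c (t + 1) s ↔ OddAvoid c t s ∧ c + 2 * t ∉ s := by
  constructor
  · intro h
    exact ⟨fun x hx => ⟨(h x hx).1, by have := (h x hx).2; omega⟩,
      fun hx => (h _ hx).2 ⟨by omega, by omega⟩⟩
  · rintro ⟨h, hb⟩ x hx
    refine ⟨(h x hx).1, ?_⟩
    have h1 := (h x hx).2
    have h2 : x ≠ c + 2 * t := fun e => hb (e ▸ hx)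
    obtain ⟨k, hk⟩ := (h x hx).1
    obtain ⟨k', hk'⟩ := hc
    omega

theorem tsum_msWeight_oddAvoid (hq : ‖q‖ < 1) {c : ℕ} (hc : Odd c) (t : ℕ) :
    ∑' s, msWeight q (OddAvoid c t) s = negqInf q * qPoch (q ^ c) (q ^ 2) t := by
  induction t with
  | zero => simp [tsum_msWeight_odd hq (fun s => oddAvoid_zero_iff), qPoch]
  | succ t ih =>
    have h := tsum_msWeight_split hq (p := OddAvoid c t) (c + 2 * t) (fun s h x hx => (h x hx).1)
    rw [tsum_msWeight_congr (fun s => oddAvoid_cons hc),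
      tsum_msWeight_congr (fun s => (oddAvoid_succ_iff hc).symm), ih] at h
    rw [← sub_eq_iff_eq_add'] at h
    rw [← h, qPoch, qPoch, prod_range_succ]
    ring

theorem qPoch_self_ne_zero {x : ℂ} (hx : ‖x‖ < 1) (n : ℕ) : qPoch x x n ≠ 0 := by
  rw [qPoch, prod_ne_zero_iff]
  intro i _ h
  rw [← pow_succ', sub_eq_zero] at h
  have := congrArg norm h
  rw [norm_one, norm_pow] at this
  have := pow_lt_one₀ (norm_nonneg x) hx (Nat.succ_ne_zero i)
  simp_all

theorem qBinom_zero_right {x : ℂ} (hx : ‖x‖ < 1) (n : ℕ) : qBinom n 0 x = 1 := by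
  have := qPoch_self_ne_zero hx n
  simp [qBinom, this, show qPoch x x 0 = 1 from prod_range_zero _]

theorem qBinom_self {x : ℂ} (hx : ‖x‖ < 1) (n : ℕ) : qBinom n n x = 1 := by
  have := qPoch_self_ne_zero hx n
  simp [qBinom, this, show qPoch x x 0 = 1 from prod_range_zero _]

/-- The `q`-Pascal recurrence. -/
theorem qBinom_pascal {x : ℂ} (hx : ‖x‖ < 1) (l r : ℕ) :
    qBinom (l + 1 + (r + 1)) (r + 1) x =
      qBinom (l + (r + 1)) (r + 1) x + x ^ (l + 1) * qBinom (l + 1 + r) r x := by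
  have hl := qPoch_self_ne_zero hx l
  have hl1 := qPoch_self_ne_zero hx (l + 1)
  have hr := qPoch_self_ne_zero hx r
  have hr1 := qPoch_self_ne_zero hx (r + 1)
  have succ : ∀ n, qPoch x x (n + 1) = qPoch x x n * (1 - x ^ (n + 1)) := fun n => by
    rw [qPoch, prod_range_succ, ← qPoch, pow_succ']
  simp only [qBinom, Nat.add_sub_cancel]
  rw [show l + 1 + (r + 1) = l + r + 1 + 1 by ring, show l + (r + 1) = l + r + 1 by ring,
    show l + 1 + r = l + r + 1 by ring]
  rw [succ (l + r + 1)]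
  rw [succ] at hl1 hr1
  rw [succ l, succ r]
  have := right_ne_zero_of_mul hl1
  have := right_ne_zero_of_mul hr1
  field_simp
  ring

theorem bandCond_split {c t r l : ℕ} {s : Multiset ℕ} (hc : Odd c) :
    BandCond c t (r + 1) l s ∧ c + 2 * t ∉ s ↔ BandCond c (t + 1) r l s := by
  have : c + 2 * (t + 1) + 2 * r = c + 2 * t + 2 * (r + 1) := by ring
  simp only [BandCond, oddAvoid_succ_iff hc, this]
  tauto

theorem bandCond_cons_succ {c t r l : ℕ} {s : Multiset ℕ} (hc : Odd c) :
    BandCond c t (r + 1) (l + 1) ((c + 2 * t) ::ₘ s) ↔ BandCond c t (r + 1) l s := by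
  simp only [BandCond, oddAvoid_cons hc, Multiset.countP_cons]
  rw [if_pos (by omega), if_pos (by omega)]
  simp

theorem not_bandCond_cons_zero {c t r : ℕ} {s : Multiset ℕ} :
    ¬ BandCond c t (r + 1) 0 ((c + 2 * t) ::ₘ s) := by
  simp only [BandCond, Multiset.countP_cons]
  rw [if_pos (by omega)]
  omega

theorem bandCond_top_iff {c t l : ℕ} {s : Multiset ℕ} :
    BandCond c t 0 l s ↔ OddAvoid c t s ∧ l < s.countP (fun x => c ≤ x ∧ x ≤ c + 2 * t) := by
  simp only [BandCond, mul_zero, add_zero]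
  refine and_congr_right fun h => and_iff_right ?_
  rw [Multiset.countP_eq_zero.2]
  · omega
  · exact fun x hx => (h x hx).2

theorem bandCond_top_cons_succ {c t l : ℕ} {s : Multiset ℕ} (hc : Odd c) :
    BandCond c t 0 (l + 1) ((c + 2 * t) ::ₘ s) ↔ BandCond c t 0 l s := by
  simp only [bandCond_top_iff, oddAvoid_cons hc, Multiset.countP_cons]
  rw [if_pos (by omega)]
  simp

theorem bandCond_top_cons_zero {c t : ℕ} {s : Multiset ℕ} (hc : Odd c) :
    BandCond c t 0 0 ((c + 2 * t) ::ₘ s) ↔ OddAvoid c t s := by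
  simp only [bandCond_top_iff, oddAvoid_cons hc, Multiset.countP_cons]
  rw [if_pos (by omega)]
  simp

theorem BandCond.odd {c t r l : ℕ} {s : Multiset ℕ} (h : BandCond c t r l s) :
    ∀ x ∈ s, Odd x := fun x hx => (h.1 x hx).1

/-- The generating function of the multisets satisfying `BandCond`. -/
theorem tsum_msWeight_bandCond (hq : ‖q‖ < 1) {c : ℕ} (hc : Odd c) (r l t : ℕ) :
    ∑' s, msWeight q (BandCond c t r l) s = q ^ (c + 2 * t + 2 * r + (c + 2 * t) * l) *
      qBinom (l + r) r (q ^ 2) * (negqInf q * qPoch (q ^ c) (q ^ 2) (t + r)) := by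
  have hq2 : ‖q ^ 2‖ < 1 := by
    rw [norm_pow]
    exact pow_lt_one₀ (norm_nonneg q) hq two_ne_zero
  induction r generalizing t l with
  | zero =>
    rw [qBinom_zero_right hq2]
    have hnot : ∀ l s, ¬ (BandCond c t 0 l s ∧ c + 2 * t ∉ s) := fun l s h => h.2 h.1.mem
    induction l with
    | zero =>
      rw [tsum_msWeight_split hq (c + 2 * t) (fun s h => h.odd), tsum_msWeight_false (hnot 0),
        tsum_msWeight_congr (fun s => bandCond_top_cons_zero hc), tsum_msWeight_oddAvoid hq hc]
      simp
    | succ l ih =>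
      rw [tsum_msWeight_split hq (c + 2 * t) (fun s h => h.odd), tsum_msWeight_false (hnot _),
        tsum_msWeight_congr (fun s => bandCond_top_cons_succ hc), ih]
      ring
  | succ r ihr =>
    induction l with
    | zero =>
      rw [tsum_msWeight_split hq (c + 2 * t) (fun s h => h.odd),
        tsum_msWeight_false (fun s => not_bandCond_cons_zero),
        tsum_msWeight_congr (fun s => bandCond_split hc), ihr, zero_add, zero_add,
        qBinom_self hq2, qBinom_self hq2, show t + 1 + r = t + (r + 1) by ring]
      ring
    | succ l ihl =>
      rw [tsum_msWeight_split hq (c + 2 * t) (fun s h => h.odd),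
        tsum_msWeight_congr (fun s => bandCond_cons_succ hc),
        tsum_msWeight_congr (fun s => bandCond_split hc), ihr, ihl, qBinom_pascal hq2,
        show t + 1 + r = t + (r + 1) by ring]
      ring

theorem summable_msWeight_family (hq : ‖q‖ < 1) {p : ℕ → Multiset ℕ → Prop} {u : ℕ → ℕ}
    (hu : Function.Injective u) (hp : ∀ m s, p m s → ∀ x ∈ s, Odd x)
    (hmem : ∀ m s, p m s → u m ∈ s) :
    Summable (fun x : Multiset ℕ × ℕ => msWeight q (p x.2) x.1) := by
  have hinj : Function.Injective (fun y : Multiset ℕ × ℕ => (u y.2 ::ₘ y.1, y.2)) := by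
    rintro ⟨s, m⟩ ⟨s', m'⟩ h
    simp only [Prod.mk.injEq] at h
    obtain ⟨h1, rfl⟩ := h
    simpa using h1
  rw [← hinj.summable_iff]
  · have h1 : Summable (fun m => ‖q‖ ^ u m) :=
      (summable_geometric_of_lt_one (norm_nonneg q) hq).comp_injective hu
    have h2 := (summable_msWeight_odd_real (norm_nonneg q) hq).mul_of_nonneg h1
      (fun s => by unfold msWeight; simp only [Pi.zero_apply]; split_ifs <;> positivity)
      (fun m => by simp only [Pi.zero_apply]; positivity)
    refine Summable.of_norm_bounded h2 ?_
    rintro ⟨s, m⟩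
    simp only [Function.comp]
    by_cases h : p m (u m ::ₘ s)
    · have hs : ∀ i ∈ s, Odd i := fun i hi => hp m _ h i (Multiset.mem_cons_of_mem hi)
      rw [msWeight, msWeight, if_pos h, if_pos hs, norm_pow, Multiset.sum_cons, pow_add, mul_comm]
    · rw [msWeight, if_neg h, norm_zero]
      unfold msWeight
      split_ifs <;> positivity
  · rintro ⟨s, m⟩ hx
    simp only [msWeight, ite_eq_right_iff]
    intro h
    obtain ⟨t, rfl⟩ := Multiset.exists_cons_of_mem (hmem m s h)
    exact absurd ⟨(t, m), rfl⟩ hx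

open Classical in
theorem card_filter_bandCond_mul {n : ℕ} (P : Nat.Partition n) (e r l : ℕ) :
    (((range (n + 1)).filter (fun m => BandCond (2 * m + e) 0 r l P.parts)).card : ℂ) * q ^ n =
      ∑' m, msWeight q (BandCond (2 * m + e) 0 r l) P.parts := by
  rw [tsum_eq_sum (s := range (n + 1)), card_filter]
  · rw [Nat.cast_sum, sum_mul]
    refine sum_congr rfl fun m _ => ?_
    simp only [msWeight, P.parts_sum]
    split_ifs <;> simp
  · intro m hm
    rw [msWeight, if_neg]
    intro h
    have := mem_parts_le P h.mem
    rw [mem_range] at hm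
    omega

theorem summable_bandCond (hq : ‖q‖ < 1) (e r l : ℕ) :
    Summable (fun x : Multiset ℕ × ℕ => msWeight q (BandCond (2 * x.2 + e) 0 r l) x.1) :=
  summable_msWeight_family hq (p := fun m => BandCond (2 * m + e) 0 r l)
    (u := fun m => 2 * m + e + 2 * 0 + 2 * r) (fun a b h => by simp only at h; omega)
    (fun _ _ h => h.odd) (fun _ _ h => h.mem)

theorem hasSum_oddParts_bandCond (hq : ‖q‖ < 1) {e : ℕ} (he : Odd e) (r l : ℕ) :
    HasSum (fun x => ∑' m, msWeight q (BandCond (2 * m + e) 0 r l) (oddParts x))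
      (negqInf q * (q ^ (e + 2 * r + e * l) * qBinom (l + r) r (q ^ 2) *
        ∑' m : ℕ, qPoch (q ^ (2 * m + e)) (q ^ 2) r * q ^ (2 * (l + 1) * m))) := by
  have hs := summable_bandCond hq e r l
  have h1 : HasSum (fun s => ∑' m, msWeight q (BandCond (2 * m + e) 0 r l) s)
      (∑' m, ∑' s, msWeight q (BandCond (2 * m + e) 0 r l) s) := by
    have hc := Summable.tsum_comm (f := fun s m => msWeight q (BandCond (2 * m + e) 0 r l) s) hs
    rw [hc]
    exact hs.prod.hasSum
  have h2 : ∑' m, ∑' s, msWeight q (BandCond (2 * m + e) 0 r l) s =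
      negqInf q * (q ^ (e + 2 * r + e * l) * qBinom (l + r) r (q ^ 2) *
        ∑' m : ℕ, qPoch (q ^ (2 * m + e)) (q ^ 2) r * q ^ (2 * (l + 1) * m)) := by
    rw [← tsum_mul_left, ← tsum_mul_left]
    refine tsum_congr fun m => ?_
    rw [tsum_msWeight_bandCond hq ((even_two_mul m).add_odd he), zero_add]
    ring
  rw [h2] at h1
  refine (oddParts_injective.hasSum_iff fun s hs => ?_).2 h1
  refine (tsum_congr fun m => ?_).trans tsum_zero
  rw [msWeight, if_neg]
  exact fun h => hs (mem_range_oddParts h.odd)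

end

theorem hookOdd_mul_pow_eq (h n : ℕ) (q : ℂ) : (hookOdd h n : ℂ) * q ^ n =
    ∑' P : {P // P ∈ Nat.Partition.odds n}, (hookCount P.1 h : ℂ) * q ^ n := by
  rw [tsum_fintype, hookOdd, Nat.cast_sum, sum_mul]
  exact (sum_coe_sort (Nat.Partition.odds n) (fun P => (hookCount P h : ℂ) * q ^ n)).symm

/-- The generating function identity for `ã_h(q)`:
`ã_h(q) = (−q;q)_∞ [ Σ_{j=0}^{⌈h/2⌉−1} q^h C(h−j−1,j)_{q²} Σ_{m≥0} (q^{2m+1};q²)_j q^{(2h−4j)m}`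
`+ Σ_{j=0}^{⌊h/2⌋−1} q^{3h−4j−3} C(h−j−2,j)_{q²} Σ_{m≥0} (q^{2m+3};q²)_j q^{(2h−4j−2)m} ]`. -/
theorem atilde_eq (h : ℕ) (hh : 1 ≤ h) (q : ℂ) (hq : ‖q‖ < 1) :
    atilde h q = negqInf q *
      ((∑ j ∈ Finset.range ((h + 1) / 2),
          q ^ h * qBinom (h - j - 1) j (q ^ 2) *
            ∑' m : ℕ, qPoch (q ^ (2 * m + 1)) (q ^ 2) j * q ^ ((2 * h - 4 * j) * m)) +
       (∑ j ∈ Finset.range (h / 2),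
          q ^ (3 * h - 4 * j - 3) * qBinom (h - j - 2) j (q ^ 2) *
            ∑' m : ℕ, qPoch (q ^ (2 * m + 3)) (q ^ 2) j * q ^ ((2 * h - 4 * j - 2) * m))) := by
  have hs := (hasSum_sum (s := range ((h + 1) / 2))
    (fun r _ => hasSum_oddParts_bandCond hq odd_one r (h - 1 - 2 * r))).add
    (hasSum_sum (s := range (h / 2))
      (fun r _ => hasSum_oddParts_bandCond hq (by decide : Odd 3) r (h - 1 - (2 * r + 1))))
  have hf : (fun x : (Σ n : ℕ, {P // P ∈ Nat.Partition.odds n}) =>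
      (hookCount x.2.1 h : ℂ) * q ^ x.1) = fun x =>
      ∑ r ∈ range ((h + 1) / 2),
        ∑' m, msWeight q (BandCond (2 * m + 1) 0 r (h - 1 - 2 * r)) (oddParts x) +
      ∑ r ∈ range (h / 2),
        ∑' m, msWeight q (BandCond (2 * m + 3) 0 r (h - 1 - (2 * r + 1))) (oddParts x) := by
    funext x
    rw [hookCount_eq x.2.1 (odd_of_mem_oddParts x), Nat.cast_add, Nat.cast_sum, Nat.cast_sum,
      add_mul, sum_mul, sum_mul]
    simp only [card_filter_bandCond_mul, oddParts]
  rw [← hf] at hs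
  rw [atilde, tsum_congr (fun n => hookOdd_mul_pow_eq h n q), ← hs.summable.tsum_sigma,
    hs.tsum_eq, mul_add, mul_sum, mul_sum]
  congr 1
  · refine sum_congr rfl fun r hr => ?_
    rw [mem_range] at hr
    obtain ⟨l, rfl⟩ : ∃ l, h = l + 1 + 2 * r := ⟨h - 1 - 2 * r, by omega⟩
    rw [show l + 1 + 2 * r - 1 - 2 * r = l by omega, show l + 1 + 2 * r - r - 1 = l + r by omega,
      show 2 * (l + 1 + 2 * r) - 4 * r = 2 * (l + 1) by omega,
      show 1 + 2 * r + 1 * l = l + 1 + 2 * r by omega]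
  · refine sum_congr rfl fun r hr => ?_
    rw [mem_range] at hr
    obtain ⟨l, rfl⟩ : ∃ l, h = l + 2 + 2 * r := ⟨h - 2 - 2 * r, by omega⟩
    rw [show l + 2 + 2 * r - 1 - (2 * r + 1) = l by omega,
      show l + 2 + 2 * r - r - 2 = l + r by omega,
      show 2 * (l + 2 + 2 * r) - 4 * r - 2 = 2 * (l + 1) by omega,
      show 3 * (l + 2 + 2 * r) - 4 * r - 3 = 3 + 2 * r + 3 * l by omega]
end

section
/- Fix nonnegative integers j, k, l with l ≥ 1 and fix 0 ≤ θ < π/2. Define F_{j,k,l}(q) := Σ_{m≥0} (q^{2m+k}; q²)_j q^{lm} for |q| < 1. Then, as z → 0 with z in the cone D_θ, z · F_{j,k,l}(e^{−z}) → ∫₀^∞ (1 − e^{−2x})^j e^{−lx} dx; equivalently F_{j,k,l}(e^{−z}) ~ (1/z) ∫₀^∞ (1 − e^{−2x})^j e^{−lx} dx. -/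
open Finset

/-- The cone `D_θ = {r e^{iα} : r ≥ 0, |α| ≤ θ}` in the right half-plane. -/
def Dcone (θ : ℝ) : Set ℂ := {z : ℂ | |z.arg| ≤ θ}

/-- `F_{j,k,l}(q) = Σ_{m≥0} (q^{2m+k}; q²)_j q^{lm}`. -/
noncomputable def Fjkl (j k l : ℕ) (q : ℂ) : ℂ :=
  ∑' m : ℕ, qPoch (q ^ (2 * m + k)) (q ^ 2) j * q ^ (l * m)

lemma prod_one_sub_eq_sum_powerset {ι R : Type*} [CommRing R] (s : Finset ι) (f : ι → R) :
    ∏ i ∈ s, (1 - f i) = ∑ t ∈ s.powerset, (-1) ^ #t * ∏ i ∈ t, f i := by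
  simp_rw [sub_eq_add_neg, Finset.prod_one_add, Finset.prod_neg]

/-- The exponent of `q` left over from the factors indexed by `t` in `(q^{2m+k}; q²)_j`. -/
def leftoverExponent (k : ℕ) (t : Finset ℕ) : ℕ := ∑ i ∈ t, (k + 2 * i)

lemma qPoch_mul_pow_eq_sum_powerset (j k l m : ℕ) (q : ℂ) :
    qPoch (q ^ (2 * m + k)) (q ^ 2) j * q ^ (l * m) =
      ∑ t ∈ (Finset.range j).powerset,
        (-1) ^ #t * q ^ leftoverExponent k t * (q ^ (2 * #t + l)) ^ m := by
  rw [qPoch, prod_one_sub_eq_sum_powerset, Finset.sum_mul]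
  refine Finset.sum_congr rfl fun t _ => ?_
  have h : ∏ i ∈ t, q ^ (2 * m + k) * (q ^ 2) ^ i =
      q ^ (#t * (2 * m)) * q ^ leftoverExponent k t := by
    rw [leftoverExponent, ← pow_add, ← smul_eq_mul #t, ← Finset.sum_const,
      ← Finset.sum_add_distrib, ← Finset.prod_pow_eq_pow_sum]
    refine Finset.prod_congr rfl fun i _ => ?_
    ring
  rw [h]
  ring

lemma Fjkl_eq_sum_powerset (j k : ℕ) {l : ℕ} (hl : 1 ≤ l) {q : ℂ} (hq : ‖q‖ < 1) :
    Fjkl j k l q = ∑ t ∈ (Finset.range j).powerset,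
      (-1) ^ #t * q ^ leftoverExponent k t * (1 - q ^ (2 * #t + l))⁻¹ := by
  simp_rw [Fjkl, qPoch_mul_pow_eq_sum_powerset]
  refine HasSum.tsum_eq (hasSum_sum fun t _ => HasSum.mul_left _ ?_)
  refine hasSum_geometric_of_norm_lt_one ?_
  rw [norm_pow]
  exact pow_lt_one₀ (norm_nonneg q) hq (by omega)

lemma tendsto_mul_inv_one_sub_exp_neg_pow {n : ℕ} (hn : n ≠ 0) :
    Filter.Tendsto (fun z : ℂ => z * (1 - Complex.exp (-z) ^ n)⁻¹)
      (nhdsWithin 0 {0}ᶜ) (nhds (n : ℂ)⁻¹) := by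
  have hd : HasDerivAt (fun z : ℂ => 1 - Complex.exp (-z) ^ n) n 0 := by
    have h := (((hasDerivAt_id (0 : ℂ)).neg.cexp).pow n).const_sub 1
    simpa using h
  refine (hd.tendsto_slope.inv₀ (Nat.cast_ne_zero.mpr hn)).congr fun z => ?_
  simp [slope_def_field, div_eq_mul_inv]

lemma integral_one_sub_exp_pow_mul_exp (j : ℕ) {l : ℕ} (hl : 1 ≤ l) :
    ∫ x in Set.Ioi (0 : ℝ), (1 - Real.exp (-2 * x)) ^ j * Real.exp (-(l : ℝ) * x) =
      ∑ t ∈ (Finset.range j).powerset, (-1) ^ #t * ((2 * #t + l : ℕ) : ℝ)⁻¹ := by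
  have hneg (t : Finset ℕ) : -((2 * #t + l : ℕ) : ℝ) < 0 :=
    neg_neg_of_pos (Nat.cast_pos.mpr (by omega))
  have hexp (x : ℝ) : (1 - Real.exp (-2 * x)) ^ j * Real.exp (-(l : ℝ) * x) =
      ∑ t ∈ (Finset.range j).powerset,
        (-1) ^ #t * Real.exp (-((2 * #t + l : ℕ) : ℝ) * x) := by
    have h := prod_one_sub_eq_sum_powerset (Finset.range j) (fun _ => Real.exp (-2 * x))
    simp only [Finset.prod_const, Finset.card_range] at h
    rw [h, Finset.sum_mul]
    refine Finset.sum_congr rfl fun t _ => ?_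
    rw [mul_assoc, ← Real.exp_nat_mul, ← Real.exp_add]
    push_cast
    ring_nf
  simp_rw [hexp]
  rw [MeasureTheory.integral_finsetSum _ fun t _ =>
    (integrableOn_exp_mul_Ioi (hneg t) 0).const_mul _]
  refine Finset.sum_congr rfl fun t _ => ?_
  rw [MeasureTheory.integral_const_mul, integral_exp_mul_Ioi (hneg t)]
  simp [neg_div_neg_eq, -neg_add_rev]

lemma norm_exp_neg_lt_one_of_mem_Dcone {θ : ℝ} (hθ : θ < Real.pi / 2) {z : ℂ}
    (hz : z ∈ Dcone θ) (hz0 : z ≠ 0) : ‖Complex.exp (-z)‖ < 1 := by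
  have hre : 0 < z.re :=
    (Complex.abs_arg_lt_pi_div_two_iff.mp (lt_of_le_of_lt hz hθ)).resolve_right hz0
  rw [Complex.norm_exp, Real.exp_lt_one_iff, Complex.neg_re]
  exact neg_neg_of_pos hre

/-- As `z → 0` in the cone `D_θ`,
`z · F_{j,k,l}(e^{−z}) → ∫₀^∞ (1 − e^{−2x})^j e^{−lx} dx`. -/
theorem Fjkl_asymptotic (j k l : ℕ) (hl : 1 ≤ l) (θ : ℝ) (hθ0 : 0 ≤ θ)
    (hθ : θ < Real.pi / 2) :
    Filter.Tendsto (fun z : ℂ => z * Fjkl j k l (Complex.exp (-z)))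
      (nhdsWithin 0 (Dcone θ \ {0}))
      (nhds ((∫ x in Set.Ioi (0 : ℝ),
        (1 - Real.exp (-2 * x)) ^ j * Real.exp (-(l : ℝ) * x) : ℝ) : ℂ)) := by
  rw [integral_one_sub_exp_pow_mul_exp j hl]
  push_cast
  have hterm : ∀ t ∈ (Finset.range j).powerset, Filter.Tendsto
      (fun z : ℂ => (-1) ^ #t * Complex.exp (-z) ^ leftoverExponent k t *
        (z * (1 - Complex.exp (-z) ^ (2 * #t + l))⁻¹))
      (nhdsWithin 0 (Dcone θ \ {0})) (nhds ((-1) ^ #t * ((2 * #t + l : ℕ) : ℂ)⁻¹)) := by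
    intro t _
    have hc : Filter.Tendsto
        (fun z : ℂ => (-1) ^ #t * Complex.exp (-z) ^ leftoverExponent k t)
        (nhdsWithin 0 (Dcone θ \ {0})) (nhds ((-1) ^ #t)) := by
      have h : Continuous
          fun z : ℂ => (-1) ^ #t * Complex.exp (-z) ^ leftoverExponent k t := by fun_prop
      simpa using (h.tendsto 0).mono_left nhdsWithin_le_nhds
    exact hc.mul ((tendsto_mul_inv_one_sub_exp_neg_pow (by omega)).mono_left
      (nhdsWithin_mono 0 fun z hz => hz.2))
  have hsum := tendsto_finsetSum _ hterm
  push_cast at hsum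
  refine hsum.congr' ?_
  filter_upwards [self_mem_nhdsWithin] with z hz
  rw [Fjkl_eq_sum_powerset j k hl (norm_exp_neg_lt_one_of_mem_Dcone hθ hz.1 hz.2),
    Finset.mul_sum]
  refine Finset.sum_congr rfl fun t _ => ?_
  ring
end

section
/- Fix integers j ≥ 1, k ≥ 1 and fix 0 ≤ θ < π/2. Define G_{j,k}(q) := Σ_{m≥0} q^{jm} / (−q^{m+1}; q)_k for |q| < 1. Then, as z → 0 with z in the cone D_θ, z · G_{j,k}(e^{−z}) → ∫₀^∞ e^{−jx}/(1 + e^{−x})^k dx; equivalently G_{j,k}(e^{−z}) ~ (1/z) ∫₀^∞ e^{−jx}/(1 + e^{−x})^k dx. -/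
open Finset

/-- `G_{j,k}(q) = Σ_{m≥0} q^{jm} / (−q^{m+1}; q)_k`. -/
noncomputable def Gjk (j k : ℕ) (q : ℂ) : ℂ :=
  ∑' m : ℕ, q ^ (j * m) / qPoch (-(q ^ (m + 1))) q k

open Filter Topology

lemma exp_neg_mem_ball {w : ℂ} (hw : 0 < w.re ∨ w = 0) :
    Complex.exp (-w) ∈ Metric.ball (1 : ℂ) 2 := by
  rcases hw with hw | rfl
  · rw [Metric.mem_ball, dist_eq_norm]
    have h1 : ‖Complex.exp (-w)‖ < 1 := by
      rw [Complex.norm_exp]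
      simpa using hw
    have h2 := norm_sub_le (Complex.exp (-w)) 1
    rw [norm_one] at h2
    linarith
  · simp

lemma one_add_ne_zero_of_mem_ball {u : ℂ} (hu : u ∈ Metric.ball (1 : ℂ) 2) : 1 + u ≠ 0 := by
  intro h
  have : u = -1 := by linear_combination h
  subst this
  rw [Metric.mem_ball, dist_eq_norm] at hu
  norm_num at hu

/-- A primitive on the right half-plane of `e^{-jw} / (1 + e^{-w})^k`, with its limits at infinity. -/
lemma exists_primitive_exp_div {j : ℕ} (hj : 1 ≤ j) (k : ℕ) :
    ∃ (F : ℂ → ℂ) (L : ℂ),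
      (∀ w : ℂ, (0 < w.re ∨ w = 0) →
        HasDerivAt F (Complex.exp (-w) ^ j / (1 + Complex.exp (-w)) ^ k) w) ∧
      ∀ {ι : Type} (l : Filter ι) (f : ι → ℂ), Tendsto (fun i => (f i).re) l atTop →
        Tendsto (fun i => F (f i)) l (𝓝 L) := by
  have hd : DifferentiableOn ℂ (fun u : ℂ => u ^ (j - 1) / (1 + u) ^ k) (Metric.ball 1 2) := by
    intro u hu
    refine DifferentiableAt.differentiableWithinAt ?_
    exact DifferentiableAt.div (by fun_prop) (by fun_prop)
      (pow_ne_zero _ (one_add_ne_zero_of_mem_ball hu))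
  obtain ⟨H, hH⟩ := hd.isExactOn_ball
  refine ⟨fun w => -H (Complex.exp (-w)), -H 0, ?_, ?_⟩
  · intro w hw
    have h1 := hH _ (exp_neg_mem_ball hw)
    have h2 : HasDerivAt (fun w : ℂ => Complex.exp (-w)) (Complex.exp (-w) * -1) w :=
      (hasDerivAt_neg w).cexp
    refine (h1.comp w h2).neg.congr_deriv ?_
    obtain ⟨n, rfl⟩ := Nat.exists_eq_add_of_le' hj
    simp only [Nat.add_sub_cancel]
    ring
  · intro ι l f hf
    have h0 : HasDerivAt H _ 0 := hH 0 (by simp [Metric.mem_ball])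
    refine (h0.continuousAt.tendsto.comp ?_).neg
    rw [tendsto_zero_iff_norm_tendsto_zero]
    simp only [Complex.norm_exp, Complex.neg_re]
    exact Real.tendsto_exp_neg_atTop_nhds_zero.comp hf

lemma integral_Ioi_exp_div_eq {j : ℕ} (hj : 1 ≤ j) (k : ℕ) {F : ℂ → ℂ} {L : ℂ}
    (hF : ∀ w : ℂ, (0 < w.re ∨ w = 0) →
      HasDerivAt F (Complex.exp (-w) ^ j / (1 + Complex.exp (-w)) ^ k) w)
    (hL : Tendsto (fun x : ℝ => F x) atTop (𝓝 L)) :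
    ((∫ x in Set.Ioi (0 : ℝ), Real.exp (-(j : ℝ) * x) / (1 + Real.exp (-x)) ^ k : ℝ) : ℂ)
      = L - F 0 := by
  have hj0 : (0 : ℝ) < j := by exact_mod_cast hj
  have hint : MeasureTheory.IntegrableOn
      (fun x : ℝ => Real.exp (-(j : ℝ) * x) / (1 + Real.exp (-x)) ^ k) (Set.Ioi 0) := by
    refine (integrableOn_exp_mul_Ioi (neg_neg_iff_pos.2 hj0) 0).mono' ?_ ?_
    · refine Continuous.aestronglyMeasurable ?_
      exact Continuous.div (by fun_prop) (by fun_prop) fun x => by positivity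
    · refine Eventually.of_forall fun x => ?_
      rw [Real.norm_of_nonneg (by positivity)]
      refine div_le_self (Real.exp_pos _).le (one_le_pow₀ ?_)
      linarith [Real.exp_pos (-x)]
  have hd : ∀ x : ℝ, 0 ≤ x → HasDerivAt (fun x : ℝ => F x)
      ((Real.exp (-(j : ℝ) * x) / (1 + Real.exp (-x)) ^ k : ℝ) : ℂ) x := by
    intro x hx
    have h := (hF x (by
      rcases hx.eq_or_lt with rfl | hx
      · simp
      · simp [hx])).comp_ofReal
    convert h using 1
    push_cast
    rw [← Complex.exp_nat_mul]
    congr 2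
    ring
  rw [← integral_complex_ofReal]
  have := MeasureTheory.integral_Ioi_of_hasDerivAt_of_tendsto
    (hd 0 le_rfl).continuousAt.continuousWithinAt (fun x hx => hd x (le_of_lt hx)) hint.ofReal hL
  simpa using this

/-- On a closed cone in the open right half-plane, `1 + e^{-w}` is bounded away from zero. -/
lemma exists_forall_le_norm_one_add_exp_neg {κ : ℝ} (hκ : 0 < κ) :
    ∃ c : ℝ, 0 < c ∧ ∀ w : ℂ, ‖w‖ * κ ≤ w.re → c ≤ ‖1 + Complex.exp (-w)‖ := by
  refine ⟨1 - Real.exp (-(Real.pi / 2 * κ)), ?_, ?_⟩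
  · rw [sub_pos, Real.exp_lt_one_iff, neg_lt_zero]
    positivity
  · intro w hw
    rcases le_total ‖w‖ (Real.pi / 2) with h | h
    · have h1 : 0 ≤ (Complex.exp (-w)).re := by
        rw [Complex.exp_re]
        refine mul_nonneg (Real.exp_pos _).le (Real.cos_nonneg_of_mem_Icc ?_)
        have := abs_le.1 ((Complex.abs_im_le_norm w).trans h)
        simp only [Complex.neg_im]
        constructor <;> linarith [this.1, this.2]
      have h2 := Complex.re_le_norm (1 + Complex.exp (-w))
      rw [Complex.add_re, Complex.one_re] at h2
      linarith [Real.exp_pos (-(Real.pi / 2 * κ))]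
    · have h1 : ‖Complex.exp (-w)‖ ≤ Real.exp (-(Real.pi / 2 * κ)) := by
        rw [Complex.norm_exp, Complex.neg_re]
        gcongr
        exact (mul_le_mul_of_nonneg_right h hκ.le).trans hw
      have h2 := norm_sub_le (1 + Complex.exp (-w)) (Complex.exp (-w))
      rw [add_sub_cancel_right, norm_one] at h2
      linarith

/-- As `z → 0`, the shifts `e^{-(i+1)z}` and `e^{-tz}` perturb `(1 + u)^{-k}` uniformly
for `u` in the closed disk away from `-1`. -/
lemma eventually_forall_norm_prod_sub_lt (j k : ℕ) {c ε : ℝ} (hc : 0 < c) (hε : 0 < ε) :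
    ∀ᶠ z : ℂ in 𝓝 0, ∀ u : ℂ, ‖u‖ ≤ 1 → c ≤ ‖1 + u‖ → ∀ t ∈ Set.Icc (0 : ℝ) 1,
      ‖Complex.exp (-(t * z)) ^ j / (1 + u * Complex.exp (-(t * z))) ^ k
        - 1 / ∏ i ∈ range k, (1 + u * Complex.exp (-z) ^ (i + 1))‖ < ε := by
  have hK : IsCompact ((Metric.closedBall (0 : ℂ) 1 ∩ {u | c ≤ ‖1 + u‖}) ×ˢ Set.Icc (0 : ℝ) 1) :=
    ((isCompact_closedBall 0 1).inter_right
      (isClosed_le continuous_const (by fun_prop))).prod isCompact_Icc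
  have := hK.eventually_forall_of_forall_eventually (x₀ := (0 : ℂ))
    (P := fun z y => ‖Complex.exp (-(y.2 * z)) ^ j / (1 + y.1 * Complex.exp (-(y.2 * z))) ^ k
        - 1 / ∏ i ∈ range k, (1 + y.1 * Complex.exp (-z) ^ (i + 1))‖ < ε) ?_
  · filter_upwards [this] with z hz u hu hcu t ht
    exact hz (u, t) ⟨⟨by simpa using hu, hcu⟩, ht⟩
  · rintro ⟨u, t⟩ ⟨⟨-, hu⟩, -⟩
    have hu0 : 1 + u ≠ 0 := norm_pos_iff.1 (hc.trans_le hu)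
    have hcont : ContinuousAt (fun p : ℂ × ℂ × ℝ =>
        ‖Complex.exp (-(p.2.2 * p.1)) ^ j / (1 + p.2.1 * Complex.exp (-(p.2.2 * p.1))) ^ k
        - 1 / ∏ i ∈ range k, (1 + p.2.1 * Complex.exp (-p.1) ^ (i + 1))‖) (0, u, t) := by
      refine ContinuousAt.norm (ContinuousAt.sub ?_ ?_)
      · exact ContinuousAt.div (by fun_prop) (by fun_prop) (by simp [hu0])
      · exact ContinuousAt.div (by fun_prop) (by fun_prop) (by simp [hu0])
    refine hcont.eventually_lt_const ?_
    simpa using hε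

lemma qPoch_neg_pow_succ (q : ℂ) (m k : ℕ) :
    qPoch (-(q ^ (m + 1))) q k = ∏ i ∈ range k, (1 + q ^ m * q ^ (i + 1)) := by
  unfold qPoch
  refine prod_congr rfl fun i _ => ?_
  ring

lemma norm_div_one_sub_exp_neg_le {z : ℂ} {κ : ℝ} (hκ : 0 < κ) (hz0 : z ≠ 0) (hz1 : ‖z‖ ≤ 1)
    (hz : ‖z‖ * κ ≤ z.re) : ‖z‖ / (1 - Real.exp (-z.re)) ≤ 2 / κ := by
  have hzn : 0 < ‖z‖ := norm_pos_iff.2 hz0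
  have hx : 0 < z.re := (mul_pos hzn hκ).trans_le hz
  have hx1 : z.re ≤ 1 := (Complex.re_le_norm z).trans hz1
  have h1 : z.re / 2 ≤ 1 - Real.exp (-z.re) := by
    have h2 : Real.exp (-z.re) ≤ 1 / (1 + z.re) := by
      rw [Real.exp_neg, ← one_div]
      exact one_div_le_one_div_of_le (by linarith) (by linarith [Real.add_one_le_exp z.re])
    have h3 : 1 / (1 + z.re) ≤ 1 - z.re / 2 := by
      rw [div_le_iff₀ (by linarith)]
      nlinarith
    linarith
  rw [div_le_div_iff₀ (by linarith) hκ]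
  linarith

/-- Comparison of `z · G_{j,k}(e^{-z})` with the telescoping sum of the primitive `F`. -/
lemma norm_mul_Gjk_sub_le {j k : ℕ} (hj : 1 ≤ j) {F : ℂ → ℂ} {L z : ℂ} {c ε : ℝ} (hc : 0 < c)
    (hz : 0 < z.re) (hε : 0 ≤ ε)
    (hF : ∀ w : ℂ, (0 < w.re ∨ w = 0) →
      HasDerivAt F (Complex.exp (-w) ^ j / (1 + Complex.exp (-w)) ^ k) w)
    (hL : Tendsto (fun m : ℕ => F (m * z)) atTop (𝓝 L))
    (hcz : ∀ m : ℕ, c ≤ ‖1 + Complex.exp (-z) ^ m‖)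
    (hu : ∀ u : ℂ, ‖u‖ ≤ 1 → c ≤ ‖1 + u‖ → ∀ t ∈ Set.Icc (0 : ℝ) 1,
      ‖Complex.exp (-(t * z)) ^ j / (1 + u * Complex.exp (-(t * z))) ^ k
        - 1 / ∏ i ∈ range k, (1 + u * Complex.exp (-z) ^ (i + 1))‖ ≤ ε) :
    ‖z * Gjk j k (Complex.exp (-z)) - (L - F 0)‖ ≤ ε * (‖z‖ / (1 - Real.exp (-z.re))) := by
  set q := Complex.exp (-z) with hq
  have hqn : ‖q‖ = Real.exp (-z.re) := by rw [hq, Complex.norm_exp, Complex.neg_re]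
  have hq1 : ‖q‖ < 1 := by rw [hqn]; simpa using hz
  have hqj : ∀ m : ℕ, ‖q ^ (j * m)‖ ≤ ‖q‖ ^ m := fun m => by
    rw [norm_pow]
    exact pow_le_pow_of_le_one (norm_nonneg _) hq1.le (Nat.le_mul_of_pos_left m hj)
  have hgeo := hasSum_geometric_of_lt_one (norm_nonneg q) hq1
  set A : ℕ → ℂ := fun m => q ^ (j * m) / qPoch (-(q ^ (m + 1))) q k with hA
  have hAs : Summable A := by
    refine Summable.of_norm_bounded (hgeo.summable.mul_right ((c ^ k)⁻¹)) fun m => ?_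
    rw [hA, norm_div, qPoch_neg_pow_succ, norm_prod, div_eq_mul_inv]
    have : c ^ k ≤ ∏ i ∈ range k, ‖1 + q ^ m * q ^ (i + 1)‖ := by
      simpa using prod_le_prod (s := range k) (f := fun _ => c) (fun _ _ => hc.le)
        fun i _ => by simpa [← pow_add] using hcz (m + (i + 1))
    have hck : 0 < c ^ k := pow_pos hc k
    gcongr
    exact hqj m
  set D : ℕ → ℂ := fun m => F ((m + 1 : ℕ) * z) - F (m * z) with hD
  have hE : ∀ m, ‖D m - z * A m‖ ≤ ε * ‖z‖ * ‖q‖ ^ m := by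
    intro m
    have hw : ∀ t : ℝ, 0 ≤ t → 0 < ((m + t : ℂ) * z).re ∨ (m + t : ℂ) * z = 0 := by
      intro t ht
      rcases (add_nonneg (Nat.cast_nonneg m) ht : (0 : ℝ) ≤ m + t).eq_or_lt with h | h
      · right
        rw [show (m + t : ℂ) = ((m + t : ℝ) : ℂ) by push_cast; rfl, ← h]
        simp
      · left
        rw [show (m + t : ℂ) = ((m + t : ℝ) : ℂ) by push_cast; rfl, Complex.re_ofReal_mul]
        exact mul_pos h hz
    have key := norm_image_sub_le_of_norm_deriv_le_segment_01'
      (f := fun t : ℝ => F ((m + t : ℂ) * z) - t * (z * A m))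
      (f' := fun t : ℝ => Complex.exp (-((m + t : ℂ) * z)) ^ j /
        (1 + Complex.exp (-((m + t : ℂ) * z))) ^ k * z - z * A m)
      (C := ε * ‖z‖ * ‖q‖ ^ m) ?_ ?_
    · have hDA : D m - z * A m = F ((m + (1 : ℝ) : ℂ) * z) - (1 : ℝ) * (z * A m) -
          (F ((m + (0 : ℝ) : ℂ) * z) - (0 : ℝ) * (z * A m)) := by
        simp only [hD]
        push_cast
        ring_nf
      rw [hDA]
      exact key
    · intro t ht
      refine HasDerivAt.hasDerivWithinAt ?_
      have h1 : HasDerivAt (fun s : ℂ => (m + s) * z) z (t : ℂ) := by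
        simpa using ((hasDerivAt_id (t : ℂ)).const_add (m : ℂ)).mul_const z
      have h2 := ((hF _ (hw t ht.1)).comp (t : ℂ) h1).comp_ofReal
      have h3 : HasDerivAt (fun s : ℝ => (s : ℂ) * (z * A m)) (z * A m) t := by
        simpa using ((hasDerivAt_id (t : ℂ)).mul_const (z * A m)).comp_ofReal
      exact h2.sub h3
    · intro t ht
      have hb := hu (q ^ m) (by rw [norm_pow]; exact pow_le_one₀ (norm_nonneg _) hq1.le) (hcz m)
        t ⟨ht.1, ht.2.le⟩
      have he : Complex.exp (-((m + t : ℂ) * z)) = q ^ m * Complex.exp (-(t * z)) := by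
        rw [hq, ← Complex.exp_nat_mul, ← Complex.exp_add]
        congr 1
        ring
      have hs : Complex.exp (-((m + t : ℂ) * z)) ^ j /
          (1 + Complex.exp (-((m + t : ℂ) * z))) ^ k * z - z * A m
          = (Complex.exp (-(t * z)) ^ j / (1 + q ^ m * Complex.exp (-(t * z))) ^ k
            - 1 / ∏ i ∈ range k, (1 + q ^ m * q ^ (i + 1))) * z * q ^ (j * m) := by
        rw [he, hA]
        simp only [qPoch_neg_pow_succ]
        ring
      rw [hs, norm_mul, norm_mul]
      gcongr
      exact hqj m
  have hbd : HasSum (fun m => ε * ‖z‖ * ‖q‖ ^ m) (ε * ‖z‖ * (1 - ‖q‖)⁻¹) := hgeo.mul_left _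
  have hEs : Summable fun m => D m - z * A m := Summable.of_norm_bounded hbd.summable hE
  have hzA : HasSum (fun m => z * A m) (z * Gjk j k q) := hAs.hasSum.mul_left z
  have hDs : Summable D := by simpa using hEs.add hzA.summable
  have hDt : HasSum D (L - F 0) := by
    refine (hDs.hasSum_iff_tendsto_nat).2 ?_
    have : ∀ n, ∑ m ∈ range n, D m = F (n * z) - F 0 := fun n => by
      simpa [hD] using sum_range_sub (fun m : ℕ => F (m * z)) n
    simp only [this]
    exact hL.sub_const _
  have := (hDt.sub hzA).norm_le_of_bounded hbd hE
  rw [norm_sub_rev, ← hqn]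
  convert this using 1
  ring

/-- As `z → 0` in the cone `D_θ`,
`z · G_{j,k}(e^{−z}) → ∫₀^∞ e^{−jx}/(1 + e^{−x})^k dx`. -/
theorem Gjk_asymptotic (j k : ℕ) (hj : 1 ≤ j) (hk : 1 ≤ k) (θ : ℝ) (hθ0 : 0 ≤ θ)
    (hθ : θ < Real.pi / 2) :
    Filter.Tendsto (fun z : ℂ => z * Gjk j k (Complex.exp (-z)))
      (nhdsWithin 0 (Dcone θ \ {0}))
      (nhds ((∫ x in Set.Ioi (0 : ℝ),
        Real.exp (-(j : ℝ) * x) / (1 + Real.exp (-x)) ^ k : ℝ) : ℂ)) := by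
  obtain ⟨F, L, hF, hL⟩ := exists_primitive_exp_div hj k
  rw [integral_Ioi_exp_div_eq hj k hF (hL _ _ (by simpa using! tendsto_id))]
  have hκ : 0 < Real.cos θ := Real.cos_pos_of_mem_Ioo ⟨by linarith [Real.pi_pos], hθ⟩
  obtain ⟨c, hc, hcw⟩ := exists_forall_le_norm_one_add_exp_neg hκ
  rw [Metric.tendsto_nhds]
  intro ε hε
  have hδ : 0 < ε * Real.cos θ / 4 := by positivity
  have hball : ∀ᶠ z : ℂ in 𝓝 0, ‖z‖ ≤ 1 := by
    filter_upwards [Metric.closedBall_mem_nhds (0 : ℂ) one_pos] with z hz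
    simpa using hz
  filter_upwards [self_mem_nhdsWithin, nhdsWithin_le_nhds hball,
    nhdsWithin_le_nhds (eventually_forall_norm_prod_sub_lt j k hc hδ)] with z hzD hz1 hu
  have hz0 : z ≠ 0 := hzD.2
  have hcone : ‖z‖ * Real.cos θ ≤ z.re := by
    rw [← Complex.norm_mul_cos_arg z, ← Real.cos_abs z.arg]
    exact mul_le_mul_of_nonneg_left (Real.cos_le_cos_of_nonneg_of_le_pi (abs_nonneg _)
      (by linarith [Real.pi_pos]) hzD.1) (norm_nonneg z)
  have hzre : 0 < z.re := (mul_pos (norm_pos_iff.2 hz0) hκ).trans_le hcone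
  rw [dist_eq_norm]
  have hmain := norm_mul_Gjk_sub_le hj hc hzre hδ.le hF
    (hL atTop (fun m : ℕ => m * z) ?_) ?_ fun u h1 h2 t ht => (hu u h1 h2 t ht).le
  · refine hmain.trans_lt ((mul_le_mul_of_nonneg_left
      (norm_div_one_sub_exp_neg_le hκ hz0 hz1 hcone) hδ.le).trans_lt ?_)
    rw [show ε * Real.cos θ / 4 * (2 / Real.cos θ) = ε / 2 by field_simp; norm_num]
    linarith
  · have : ∀ m : ℕ, ((m : ℂ) * z).re = m * z.re := fun m => by simp
    simp only [this]
    exact tendsto_natCast_atTop_atTop.atTop_mul_const hzre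
  · intro m
    have := hcw (m * z) (by
      rw [norm_mul, Complex.norm_natCast, mul_assoc]
      simpa using mul_le_mul_of_nonneg_left hcone (Nat.cast_nonneg m))
    rwa [← mul_neg, Complex.exp_nat_mul] at this
end
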